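/- Every biautomatic group has a factorial automatic structure admitting a departure function: if a group G admits a biautomatic structure L ⊆ A* for a surjective monoid homomorphism π : A* → G, then there exists a factorial automatic structure L̃ ⊆ A* for π that admits a departure function. -/

import Mathlib

open scoped NNReal

namespace Auto

/-- The generating set `Aπ ∪ (Aπ)⁻¹` of `G` determined by `π : A* → G`. -/
def gens {A G : Type*} [Group G] (π : FreeMonoid A →* G) : Set G :=
  (Set.range fun a : A => π (FreeMonoid.of a)) ∪
    Set.range fun a : A => (π (FreeMonoid.of a))⁻¹

/-- The word metric `d_A` on `G`: the least `n` such that `g⁻¹h` is a product of `n`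
elements of `Aπ ∪ (Aπ)⁻¹`. -/
noncomputable def wdist {A G : Type*} [Group G] (π : FreeMonoid A →* G) (g h : G) : ℕ :=
  sInf {n : ℕ | ∃ l : List G, l.length = n ∧ (∀ x ∈ l, x ∈ gens π) ∧ l.prod = g⁻¹ * h}

/-- Evaluation of a word of `A*` in `G`. -/
def evalW {A G : Type*} [Group G] (π : FreeMonoid A →* G) (w : List A) : G :=
  π (FreeMonoid.ofList w)

/-- `u` and `v` `p`-fellow travel: `d_A(u^[n]π, v^[n]π) ≤ p` for all `n`. -/
def FellowTravel {A G : Type*} [Group G] (π : FreeMonoid A →* G) (p : ℝ≥0)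
    (u v : List A) : Prop :=
  ∀ n : ℕ, (wdist π (evalW π (u.take n)) (evalW π (v.take n)) : ℝ≥0) ≤ p

/-- `u` and `v` are `p`-meeting-fellow-travellers. -/
def MFT {A G : Type*} [Group G] (π : FreeMonoid A →* G) (p : ℝ≥0) (u v : List A) : Prop :=
  FellowTravel π p u v ∧ evalW π u = evalW π v

/-- A language is regular if it is accepted by a finite-state automaton. -/
def IsRegular {A : Type*} (L : Language A) : Prop :=
  ∃ (σ : Type) (_ : Fintype σ) (M : DFA A σ), M.accepts = L

/-- `L` is an automatic structure for `π`. -/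
structure IsAutomaticStructure {A G : Type*} [Group G] (π : FreeMonoid A →* G)
    (L : Language A) : Prop where
  regular : IsRegular L
  onto : ∀ g : G, ∃ w ∈ L, evalW π w = g
  ft : ∃ N : ℕ, ∀ u ∈ L, ∀ v ∈ L,
    wdist π (evalW π u) (evalW π v) ≤ 1 → FellowTravel π N u v

/-- Evaluation of an element of `A ∪ {ε}`. -/
def evalOpt {A G : Type*} [Group G] (π : FreeMonoid A →* G) : Option A → G
  | none => 1
  | some a => π (FreeMonoid.of a)

/-- `L` is a biautomatic structure for `π`. -/
structure IsBiautomaticStructure {A G : Type*} [Group G] (π : FreeMonoid A →* G)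
    (L : Language A) extends IsAutomaticStructure π L : Prop where
  bi : ∃ N : ℕ, ∀ u ∈ L, ∀ v ∈ L, ∀ a : Option A,
    evalW π v = evalOpt π a * evalW π u →
    ∀ n : ℕ, wdist π (evalOpt π a * evalW π (u.take n)) (evalW π (v.take n)) ≤ N

/-- A language is factorial if it is closed under taking factors. -/
def IsFactorial {A : Type*} (L : Language A) : Prop :=
  ∀ u ∈ L, ∀ v : List A, v <:+: u → v ∈ L

/-- `D : ℝ≥0 → ℝ≥0` is a departure function for `(G, L)`. -/
def IsDepartureFunction {A G : Type*} [Group G] (π : FreeMonoid A →* G) (L : Language A)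
    (D : ℝ≥0 → ℝ≥0) : Prop :=
  ∀ w ∈ L, ∀ r : ℝ≥0, ∀ s t : ℕ, D r ≤ (t : ℝ≥0) → s + t ≤ w.length →
    r < (wdist π (evalW π (w.take s)) (evalW π (w.take (s + t))) : ℝ≥0)

/-- Every point of `S` is within distance `N` of `T`. -/
def NbhdIn {A G : Type*} [Group G] (π : FreeMonoid A →* G) (N : ℕ) (S T : Set G) : Prop :=
  ∀ s ∈ S, ∃ t ∈ T, wdist π s t ≤ N

/-- The Hausdorff distance between `S` and `T` is at most `N`. -/
def HausdorffLE {A G : Type*} [Group G] (π : FreeMonoid A →* G) (N : ℕ)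
    (S T : Set G) : Prop :=
  NbhdIn π N S T ∧ NbhdIn π N T S

/-- `H` is an `L`-quasiconvex subgroup of `G`. -/
def IsQuasiconvex {A G : Type*} [Group G] (π : FreeMonoid A →* G) (L : Language A)
    (H : Subgroup G) : Prop :=
  ∃ k : ℕ, ∀ h ∈ H, ∀ h' ∈ H, ∀ w ∈ L, h * evalW π w = h' →
    ∀ n : ℕ, ∃ z ∈ H, wdist π (h * evalW π (w.take n)) z ≤ k

/-- The bounded reduction property for `(φ, L, L')`. -/
def BRP {A B G G' : Type*} [Group G] [Group G'] (π : FreeMonoid A →* G)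
    (π' : FreeMonoid B →* G') (φ : G →* G') (L : Language A) (L' : Language B) : Prop :=
  ∃ N : ℕ, ∀ x : G, ∀ α ∈ L, ∀ β ∈ L', evalW π' β = φ (evalW π α) →
    HausdorffLE π' N (Set.range fun n : ℕ => φ (x * evalW π (α.take n)))
      (Set.range fun n : ℕ => φ x * evalW π' (β.take n))

/-- The synchronous bounded reduction property for `(φ, L, L')`. -/
def SyncBRP {A B G G' : Type*} [Group G] [Group G'] (π : FreeMonoid A →* G)
    (π' : FreeMonoid B →* G') (φ : G →* G') (L : Language A) (L' : Language B) : Prop :=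
  ∃ N : ℕ, ∀ x : G, ∀ α ∈ L, ∀ β ∈ L', evalW π' β = φ (evalW π α) →
    ∀ n : ℕ, wdist π' (φ (x * evalW π (α.take n))) (φ x * evalW π' (β.take n)) ≤ N

/-- The fellow traveller bounded reduction property (FT-BRP) for `(φ, L, L')`. -/
def FTBRP {A B G G' : Type*} [Group G] [Group G'] (π : FreeMonoid A →* G)
    (π' : FreeMonoid B →* G') (φ : G →* G') (L : Language A) (L' : Language B) : Prop :=
  ∀ p : ℝ≥0, ∃ q : ℝ≥0,
    ∀ u₁ ∈ L, ∀ u₂ ∈ L, ∀ u₃ ∈ L, ∀ u₁' ∈ L', ∀ u₂' ∈ L', ∀ u₃' ∈ L',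
      evalW π' u₁' = φ (evalW π u₁) → evalW π' u₂' = φ (evalW π u₂) →
        evalW π' u₃' = φ (evalW π u₃) →
          MFT π p (u₁ ++ u₂) u₃ → MFT π' q (u₁' ++ u₂') u₃'

/-- The natural homomorphism `(A ⊔ B)* → G` agreeing with `π₁` on `A` and `π₂` on `B`. -/
def sumHom {A B G : Type*} [Group G] (π₁ : FreeMonoid A →* G) (π₂ : FreeMonoid B →* G) :
    FreeMonoid (A ⊕ B) →* G :=
  FreeMonoid.lift (Sum.elim (fun a => π₁ (FreeMonoid.of a)) fun b => π₂ (FreeMonoid.of b))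

/-- The union `L₁ ∪ L₂` viewed as a language over `A ⊔ B`. -/
def unionLang {A B : Type*} (L₁ : Language A) (L₂ : Language B) : Language (A ⊕ B) :=
  {w : List (A ⊕ B) | (∃ u ∈ L₁, w = u.map Sum.inl) ∨ ∃ v ∈ L₂, w = v.map Sum.inr}

/-- `L` is an asynchronous automatic structure for `π`. -/
def IsAsyncAutomaticStructure {A G : Type*} [Group G] (π : FreeMonoid A →* G)
    (L : Language A) : Prop :=
  IsRegular L ∧ (∀ g : G, ∃ w ∈ L, evalW π w = g) ∧
    ∃ p : ℕ, ∀ u ∈ L, ∀ v ∈ L, wdist π (evalW π u) (evalW π v) ≤ 1 →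
      ∃ φ ψ : ℕ → ℕ, Monotone φ ∧ Monotone ψ ∧
        Function.Surjective φ ∧ Function.Surjective ψ ∧
          ∀ t : ℕ, wdist π (evalW π (u.take (φ t))) (evalW π (v.take (ψ t))) ≤ p

/-- `L₁` and `L₂` are equivalent automatic structures. -/
def LangEquivalent {A B G : Type*} [Group G] (π₁ : FreeMonoid A →* G)
    (π₂ : FreeMonoid B →* G) (L₁ : Language A) (L₂ : Language B) : Prop :=
  IsAsyncAutomaticStructure (sumHom π₁ π₂) (unionLang L₁ L₂)

/-- `L₁` and `L₂` are synchronously equivalent automatic structures. -/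
def LangSyncEquivalent {A B G : Type*} [Group G] (π₁ : FreeMonoid A →* G)
    (π₂ : FreeMonoid B →* G) (L₁ : Language A) (L₂ : Language B) : Prop :=
  IsAutomaticStructure (sumHom π₁ π₂) (unionLang L₁ L₂)

/-- `L` has the Hausdorff closeness property. -/
def HausClose {A G : Type*} [Group G] (π : FreeMonoid A →* G) (L : Language A) : Prop :=
  ∃ N : ℕ, ∀ u ∈ L, ∀ v ∈ L, wdist π (evalW π u) (evalW π v) ≤ 1 →
    HausdorffLE π N (Set.range fun n : ℕ => evalW π (u.take n))
      (Set.range fun n : ℕ => evalW π (v.take n))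

/-- The padded alphabet `C = (A×B) ∪ (A×{$}) ∪ ({$}×B)` of convolution. -/
abbrev ConvAlphabet (A B : Type*) := (A × B) ⊕ (A ⊕ B)

/-- The convolution `u ⋄ v` of two words. -/
def conv {A B : Type*} : List A → List B → List (ConvAlphabet A B)
  | [], [] => []
  | [], b :: v => Sum.inr (Sum.inr b) :: conv [] v
  | a :: u, [] => Sum.inr (Sum.inl a) :: conv u []
  | a :: u, b :: v => Sum.inl (a, b) :: conv u v
  termination_by u v => u.length + v.length

/-- The convolution `L₁ ⋄ L₂` of two languages. -/
def convLang {A B : Type*} (L₁ : Language A) (L₂ : Language B) :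
    Language (ConvAlphabet A B) :=
  {w : List (ConvAlphabet A B) | ∃ u ∈ L₁, ∃ v ∈ L₂, w = conv u v}

/-- The natural homomorphism `C* → G × G'` for the convolution alphabet. -/
def convHom {A B G G' : Type*} [Group G] [Group G'] (π₁ : FreeMonoid A →* G)
    (π₂ : FreeMonoid B →* G') : FreeMonoid (ConvAlphabet A B) →* G × G' :=
  FreeMonoid.lift fun c =>
    match c with
    | Sum.inl (a, b) => (π₁ (FreeMonoid.of a), π₂ (FreeMonoid.of b))
    | Sum.inr (Sum.inl a) => (π₁ (FreeMonoid.of a), 1)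
    | Sum.inr (Sum.inr b) => (1, π₂ (FreeMonoid.of b))

/-- A group is automatic if it admits an automatic structure over some finite alphabet. -/
def IsAutomaticGroup (G : Type*) [Group G] : Prop :=
  ∃ (A : Type) (_ : Fintype A) (π : FreeMonoid A →* G) (L : Language A),
    IsAutomaticStructure π L

end Auto

open Auto

namespace Auto

section Helpers

variable {A G : Type*} [Group G]

theorem regular_of_sig {L : Language A} {τ : Type*} [Finite τ] (Φ : List A → τ)
    (h : ∀ w w' z : List A, Φ w = Φ w' → w ++ z ∈ L → w' ++ z ∈ L) : IsRegular L := by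
  have : L.IsRegular := by
    apply Language.IsRegular.of_finite_range_leftQuotient
    refine (Set.finite_range
      (fun t : τ => ({z | ∃ w, Φ w = t ∧ w ++ z ∈ L} : Language A))).subset ?_
    rintro _ ⟨w, rfl⟩
    refine ⟨Φ w, ?_⟩
    ext z
    constructor
    · rintro ⟨w', hw', hz⟩
      exact h _ _ _ hw' hz
    · intro hz
      exact ⟨w, rfl, hz⟩
  exact this

theorem evalW_append (π : FreeMonoid A →* G) (u v : List A) :
    evalW π (u ++ v) = evalW π u * evalW π v := by
  simp [evalW, FreeMonoid.ofList_append]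

theorem evalW_nil (π : FreeMonoid A →* G) : evalW π [] = 1 := by
  simp [evalW]

theorem wdist_le_of (π : FreeMonoid A →* G) {g h : G} (l : List G)
    (hl : ∀ x ∈ l, x ∈ gens π) (hp : l.prod = g⁻¹ * h) : wdist π g h ≤ l.length :=
  Nat.sInf_le ⟨l, rfl, hl, hp⟩

theorem evalW_eq_prod (π : FreeMonoid A →* G) (w : List A) :
    evalW π w = (w.map fun a => π (FreeMonoid.of a)).prod := by
  induction w with
  | nil => simp [evalW]
  | cons a w ih =>
    rw [List.map_cons, List.prod_cons, ← ih]
    simp [evalW, FreeMonoid.ofList_cons]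

theorem wdist_evalW_le (π : FreeMonoid A →* G) (g : G) (w : List A) :
    wdist π g (g * evalW π w) ≤ w.length := by
  have := wdist_le_of π (g := g) (h := g * evalW π w) (w.map fun a => π (FreeMonoid.of a)) ?_ ?_
  · simpa using this
  · intro x hx
    obtain ⟨a, _, rfl⟩ := List.mem_map.1 hx
    exact Or.inl ⟨a, rfl⟩
  · rw [← evalW_eq_prod]; group

theorem exists_list (π : FreeMonoid A →* G) (hπ : Function.Surjective π) (g h : G) :
    ∃ l : List G, l.length = wdist π g h ∧ (∀ x ∈ l, x ∈ gens π) ∧ l.prod = g⁻¹ * h := by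
  have : (wdist π g h) ∈
      {n : ℕ | ∃ l : List G, l.length = n ∧ (∀ x ∈ l, x ∈ gens π) ∧ l.prod = g⁻¹ * h} := by
    apply Nat.sInf_mem
    obtain ⟨w, hw⟩ := hπ (g⁻¹ * h)
    refine ⟨_, (FreeMonoid.toList w).map fun a => π (FreeMonoid.of a), rfl, ?_, ?_⟩
    · intro x hx
      obtain ⟨a, _, rfl⟩ := List.mem_map.1 hx
      exact Or.inl ⟨a, rfl⟩
    · rw [← evalW_eq_prod, ← hw]; simp [evalW]
  exact this

theorem wdist_mul_left (π : FreeMonoid A →* G) (x g h : G) :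
    wdist π (x * g) (x * h) = wdist π g h := by
  have : (x * g)⁻¹ * (x * h) = g⁻¹ * h := by group
  simp only [wdist, this]

theorem wdist_self (π : FreeMonoid A →* G) (g : G) : wdist π g g = 0 := by
  have := wdist_le_of π (g := g) (h := g) [] (by simp) (by simp)
  simpa using this

theorem inv_mem_gens (π : FreeMonoid A →* G) {x : G} (h : x ∈ gens π) : x⁻¹ ∈ gens π := by
  rcases h with ⟨a, rfl⟩ | ⟨a, rfl⟩
  · exact Or.inr ⟨a, rfl⟩
  · exact Or.inl ⟨a, by simp⟩

theorem wdist_comm_le (π : FreeMonoid A →* G) (hπ : Function.Surjective π) (g h : G) :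
    wdist π h g ≤ wdist π g h := by
  obtain ⟨l, h1, h2, h3⟩ := exists_list π hπ g h
  rw [← h1]
  have := wdist_le_of π (g := h) (h := g) (l.map (·⁻¹)).reverse ?_ ?_
  · simpa using this
  · intro x hx
    simp only [List.mem_reverse, List.mem_map] at hx
    obtain ⟨a, ha, rfl⟩ := hx
    exact inv_mem_gens π (h2 a ha)
  · rw [← List.prod_inv_reverse, h3]; group

theorem wdist_comm (π : FreeMonoid A →* G) (hπ : Function.Surjective π) (g h : G) :
    wdist π h g = wdist π g h :=
  le_antisymm (wdist_comm_le π hπ g h) (wdist_comm_le π hπ h g)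

theorem wdist_triangle (π : FreeMonoid A →* G) (hπ : Function.Surjective π) (g h k : G) :
    wdist π g k ≤ wdist π g h + wdist π h k := by
  obtain ⟨l, h1, h2, h3⟩ := exists_list π hπ g h
  obtain ⟨m, h1', h2', h3'⟩ := exists_list π hπ h k
  rw [← h1, ← h1', ← List.length_append]
  apply wdist_le_of
  · intro x hx
    rcases List.mem_append.1 hx with hx | hx
    · exact h2 x hx
    · exact h2' x hx
  · rw [List.prod_append, h3, h3']; group

theorem ball_finite [Finite A] (π : FreeMonoid A →* G) (hπ : Function.Surjective π) (n : ℕ) :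
    {g : G | wdist π 1 g ≤ n}.Finite := by
  have hg : (gens π).Finite := (Set.finite_range _).union (Set.finite_range _)
  have : Finite (gens π) := hg
  refine ((List.finite_length_le (gens π) n).image
    (fun l => (l.map Subtype.val).prod)).subset ?_
  intro g hg
  obtain ⟨l, h1, h2, h3⟩ := exists_list π hπ 1 g
  refine ⟨l.attachWith (· ∈ gens π) h2, ?_, ?_⟩
  · simp only [Set.mem_setOf_eq] at hg ⊢
    simp [h1, hg]
  · simp [h3]

/-- Distance from the identity is subadditive. -/
theorem wdist_one_mul (π : FreeMonoid A →* G) (hπ : Function.Surjective π) (g h : G) :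
    wdist π 1 (g * h) ≤ wdist π 1 g + wdist π 1 h := by
  have h1 := wdist_triangle π hπ 1 g (g * h)
  have h2 := wdist_mul_left π g 1 h
  rw [mul_one] at h2
  omega

theorem wdist_eq_one (π : FreeMonoid A →* G) (g h : G) :
    wdist π g h = wdist π 1 (g⁻¹ * h) := by
  rw [← wdist_mul_left π g⁻¹ g h, inv_mul_cancel]

theorem wdist_one_inv (π : FreeMonoid A →* G) (hπ : Function.Surjective π) (g : G) :
    wdist π 1 g⁻¹ = wdist π 1 g := by
  rw [← wdist_comm π hπ, wdist_eq_one π g⁻¹ 1]; simp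

theorem wdist_one_evalW (π : FreeMonoid A →* G) (w : List A) :
    wdist π 1 (evalW π w) ≤ w.length := by
  simpa using wdist_evalW_le π 1 w

/-- Moving along a word. -/
theorem wdist_take_take (π : FreeMonoid A →* G) (w : List A) (i j : ℕ) (hij : i ≤ j) :
    wdist π (evalW π (w.take i)) (evalW π (w.take j)) ≤ min j w.length - min i w.length := by
  have h : w.take j = w.take i ++ (w.take j).drop i := by
    have := List.take_append_drop i (w.take j)
    rw [List.take_take, min_eq_left hij] at this
    exact this.symm
  rw [h, evalW_append]
  refine (wdist_evalW_le π _ _).trans ?_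
  simp only [List.length_drop, List.length_take]
  omega

theorem ft_right (π : FreeMonoid A →* G) {L : Language A} {N : ℕ}
    (onto : ∀ g : G, ∃ w ∈ L, evalW π w = g)
    (hπ : Function.Surjective π)
    (ft : ∀ u ∈ L, ∀ v ∈ L, wdist π (evalW π u) (evalW π v) ≤ 1 →
      ∀ n : ℕ, wdist π (evalW π (u.take n)) (evalW π (v.take n)) ≤ N)
    (l : List G) (hl : ∀ x ∈ l, x ∈ gens π) :
    ∀ u ∈ L, ∀ v ∈ L, evalW π v = evalW π u * l.prod →
      ∀ n, wdist π (evalW π (u.take n)) (evalW π (v.take n)) ≤ N * (l.length + 1) := by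
  induction l with
  | nil =>
    intro u hu v hv h n
    have := ft u hu v hv (by rw [h]; simp [wdist_self]) n
    simpa using this
  | cons a l ih =>
    intro u hu v hv h n
    obtain ⟨m, hm, hmu⟩ := onto (evalW π u * a)
    have h1 := ft u hu m hm (by
      have := wdist_le_of π (g := evalW π u) (h := evalW π m) [a]
        (by intro x hx; exact hl x (by simp at hx; simp [hx])) (by rw [hmu]; simp)
      simpa using this) n
    have h2 := ih (fun x hx => hl x (by simp [hx])) m hm v hv
      (by rw [h, hmu, List.prod_cons, mul_assoc]) n
    have h3 := wdist_triangle π hπ (evalW π (u.take n)) (evalW π (m.take n)) (evalW π (v.take n))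
    simp only [List.length_cons]
    rw [mul_add N (l.length + 1) 1]
    omega

theorem ft_left (π : FreeMonoid A →* G) {L : Language A} {N : ℕ}
    (onto : ∀ g : G, ∃ w ∈ L, evalW π w = g)
    (hπ : Function.Surjective π)
    (bi : ∀ u ∈ L, ∀ v ∈ L, ∀ a : Option A, evalW π v = evalOpt π a * evalW π u →
      ∀ n : ℕ, wdist π (evalOpt π a * evalW π (u.take n)) (evalW π (v.take n)) ≤ N)
    (l : List G) (hl : ∀ x ∈ l, x ∈ gens π) :
    ∀ u ∈ L, ∀ v ∈ L, evalW π v = l.prod * evalW π u →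
      ∀ n, wdist π (l.prod * evalW π (u.take n)) (evalW π (v.take n)) ≤ N * (l.length + 1) := by
  induction l with
  | nil =>
    intro u hu v hv h n
    have := bi u hu v hv none (by simpa [evalOpt] using h) n
    simpa [evalOpt] using this
  | cons a l ih =>
    intro u hu v hv h n
    obtain ⟨m, hm, hmu⟩ := onto (l.prod * evalW π u)
    have h2 := ih (fun x hx => hl x (by simp [hx])) u hu m hm hmu n
    have h1 : wdist π (a * evalW π (m.take n)) (evalW π (v.take n)) ≤ N := by
      rcases hl a (by simp) with ⟨b, rfl⟩ | ⟨b, rfl⟩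
      · exact bi m hm v hv (some b) (by simp only [evalOpt]; rw [h, hmu]; simp [mul_assoc]) n
      · have := bi v hv m hm (some b)
          (by simp only [evalOpt]; rw [h, hmu]; simp [mul_assoc]) n
        rw [wdist_comm π hπ, ← wdist_mul_left π (π (FreeMonoid.of b))]
        simpa [evalOpt] using this
    have h3 := wdist_triangle π hπ ((a :: l).prod * evalW π (u.take n))
      (a * evalW π (m.take n)) (evalW π (v.take n))
    rw [List.prod_cons, mul_assoc, wdist_mul_left] at h3
    simp only [List.length_cons, List.prod_cons]
    rw [mul_add N (l.length + 1) 1, mul_assoc]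
    omega

/-- Two-sided fellow travelling in a biautomatic structure. -/
theorem ft_both (π : FreeMonoid A →* G) (hπ : Function.Surjective π) {L : Language A}
    (hL : IsBiautomaticStructure π L) (k : ℕ) :
    ∃ K : ℕ, ∀ u ∈ L, ∀ v ∈ L, ∀ h h' : G, wdist π 1 h ≤ k → wdist π 1 h' ≤ k →
      evalW π v = h * evalW π u * h' →
      ∀ n, wdist π (h * evalW π (u.take n)) (evalW π (v.take n)) ≤ K := by
  obtain ⟨N, hN⟩ := hL.ft
  obtain ⟨N', hN'⟩ := hL.bi
  have onto := hL.onto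
  refine ⟨N' * (k + 1) + N * (k + 1), ?_⟩
  intro u hu v hv h h' hh hh' huv n
  obtain ⟨l, l1, l2, l3⟩ := exists_list π hπ 1 h
  obtain ⟨l', l1', l2', l3'⟩ := exists_list π hπ 1 h'
  simp only [inv_one, one_mul] at l3 l3'
  obtain ⟨m, hm, hmu⟩ := onto (h * evalW π u)
  have e1 := ft_left π onto hπ hN' l l2 u hu m hm (by rw [hmu, l3]) n
  have e2 := ft_right π onto hπ
    (fun u hu v hv huv n => by have := hN u hu v hv huv n; exact_mod_cast this)
    l' l2' m hm v hv (by rw [huv, hmu, l3']) n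
  have e3 := wdist_triangle π hπ (h * evalW π (u.take n)) (evalW π (m.take n)) (evalW π (v.take n))
  rw [l3] at e1
  have e4 : N' * (l.length + 1) ≤ N' * (k + 1) := Nat.mul_le_mul_left _ (by omega)
  have e5 : N * (l'.length + 1) ≤ N * (k + 1) := Nat.mul_le_mul_left _ (by omega)
  omega

/-- Words of `L` that have minimal length among the representatives in `L`. -/
def minLang (π : FreeMonoid A →* G) (L : Language A) : Language A :=
  {w | w ∈ L ∧ ∀ v ∈ L, evalW π v = evalW π w → w.length ≤ v.length}

/-- The language of factors. -/
def facLang (L : Language A) : Language A :=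
  {w | ∃ x y, x ++ w ++ y ∈ L}

theorem minLang_onto (π : FreeMonoid A →* G) {L : Language A}
    (onto : ∀ g : G, ∃ w ∈ L, evalW π w = g) (g : G) : ∃ w ∈ minLang π L, evalW π w = g := by
  classical
  have hex : ∃ n, ∃ w ∈ L, evalW π w = g ∧ w.length = n := by
    obtain ⟨w, hw, h⟩ := onto g
    exact ⟨_, w, hw, h, rfl⟩
  obtain ⟨w, hw, h, hn⟩ := Nat.find_spec hex
  refine ⟨w, ⟨hw, ?_⟩, h⟩
  intro v hv hvw
  rw [hn]
  exact Nat.find_min' hex ⟨v, hv, hvw.trans h, rfl⟩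

theorem minLang_regular [Finite A] (π : FreeMonoid A →* G) (hπ : Function.Surjective π)
    {L : Language A} (hL : IsAutomaticStructure π L) : IsRegular (minLang π L) := by
  obtain ⟨σ, _, M, hM⟩ := hL.regular
  obtain ⟨N, hN⟩ := hL.ft
  have hfin := ball_finite π hπ N
  let B : Set G := {g : G | wdist π 1 g ≤ N}
  have hB : Finite B := hfin
  let S : List A → Set (B × σ) := fun w => {p | ∃ v : List A, v.length = w.length ∧
    M.eval v = p.2 ∧ evalW π v = evalW π w * p.1}
  let T : List A → Set B := fun w => {p | ∃ v ∈ L, v.length < w.length ∧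
    evalW π v = evalW π w * p}
  have hmem : ∀ u v : List A, u ++ v ∈ L ↔ M.evalFrom (M.eval u) v ∈ M.accept := by
    intro u v
    rw [← hM, DFA.mem_accepts, DFA.eval, DFA.evalFrom_of_append]
  refine regular_of_sig (fun w => (M.eval w, S w, T w)) ?_
  intro w w' z hΦ hwz
  simp only [Prod.mk.injEq] at hΦ
  obtain ⟨h1, h2, h3⟩ := hΦ
  obtain ⟨hwL, hmin⟩ := hwz
  have hw'L : w' ++ z ∈ L := by rw [hmem, ← h1, ← hmem]; exact hwL
  refine ⟨hw'L, ?_⟩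
  intro v hv hvw
  by_contra hlt
  simp only [not_le, List.length_append] at hlt
  have hft : wdist π (evalW π w') (evalW π (v.take w'.length)) ≤ N := by
    have := hN (w' ++ z) hw'L v hv (by rw [hvw, wdist_self]; omega) w'.length
    rw [List.take_left] at this
    exact_mod_cast this
  rw [wdist_eq_one] at hft
  by_cases hc : v.length < w'.length
  · rw [List.take_of_length_le hc.le] at hft
    have : (⟨_, hft⟩ : B) ∈ T w' := ⟨v, hv, hc, by simp⟩
    rw [← h3] at this
    obtain ⟨v', hv', hl, he⟩ := this
    have := hmin v' hv' (by
      rw [he, evalW_append]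
      rw [evalW_append] at hvw
      simp [hvw])
    simp only [List.length_append] at this
    omega
  · have : ((⟨_, hft⟩ : B), M.eval (v.take w'.length)) ∈ S w' :=
      ⟨v.take w'.length, by simp; omega, rfl, by simp⟩
    rw [← h2] at this
    obtain ⟨v', hl, hq, he⟩ := this
    have hvsplit := List.take_append_drop w'.length v
    have hv'L : v' ++ v.drop w'.length ∈ L := by
      rw [hmem, hq]
      simp only
      rw [← hmem, hvsplit]
      exact hv
    have := hmin _ hv'L (by
      rw [evalW_append, he, evalW_append]
      rw [← hvsplit, evalW_append, evalW_append] at hvw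
      simp only [mul_assoc, mul_right_inj] at hvw ⊢
      rw [hvw]; simp)
    simp only [List.length_append, List.length_drop] at this
    omega

theorem facLang_regular {L : Language A} (h : IsRegular L) : IsRegular (facLang L) := by
  obtain ⟨σ, _, M, hM⟩ := h
  have hmem : ∀ u v : List A, u ++ v ∈ L ↔ M.evalFrom (M.eval u) v ∈ M.accept := by
    intro u v
    rw [← hM, DFA.mem_accepts, DFA.eval, DFA.evalFrom_of_append]
  refine regular_of_sig (τ := Set σ) (fun w => {q | ∃ x, M.eval (x ++ w) = q}) ?_
  rintro w w' z hΦ ⟨x, y, hxy⟩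
  have : M.eval (x ++ w) ∈ {q | ∃ x, M.eval (x ++ w) = q} := ⟨x, rfl⟩
  rw [hΦ] at this
  obtain ⟨x', hx'⟩ := this
  refine ⟨x', y, ?_⟩
  have e : x' ++ (w' ++ z) ++ y = (x' ++ w') ++ (z ++ y) := by simp
  have e' : x ++ (w ++ z) ++ y = (x ++ w) ++ (z ++ y) := by simp
  rw [e, hmem, hx', ← hmem, ← e']
  exact hxy

theorem facLang_bounded {L : Language A} (h : IsRegular L) :
    ∃ C : ℕ, ∀ w ∈ facLang L, ∃ x y : List A, x.length ≤ C ∧ y.length ≤ C ∧ x ++ w ++ y ∈ L := by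
  classical
  obtain ⟨σ, _, M, hM⟩ := h
  have hmem : ∀ u v : List A, u ++ v ∈ L ↔ M.evalFrom (M.eval u) v ∈ M.accept := by
    intro u v
    rw [← hM, DFA.mem_accepts, DFA.eval, DFA.evalFrom_of_append]
  have hf : ∀ q : σ, ∃ x : List A, (∃ x', M.eval x' = q) → M.eval x = q := by
    intro q
    by_cases hq : ∃ x', M.eval x' = q
    · obtain ⟨x, hx⟩ := hq
      exact ⟨x, fun _ => hx⟩
    · exact ⟨[], fun h => absurd h hq⟩
  have hg : ∀ q : σ, ∃ y : List A, (∃ y', M.evalFrom q y' ∈ M.accept) →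
      M.evalFrom q y ∈ M.accept := by
    intro q
    by_cases hq : ∃ y', M.evalFrom q y' ∈ M.accept
    · obtain ⟨x, hx⟩ := hq
      exact ⟨x, fun _ => hx⟩
    · exact ⟨[], fun h => absurd h hq⟩
  choose f hf using hf
  choose g hg using hg
  refine ⟨∑ q, ((f q).length + (g q).length), ?_⟩
  have hle : ∀ q, (f q).length + (g q).length ≤ ∑ q, ((f q).length + (g q).length) := fun q =>
    Finset.single_le_sum (f := fun q => (f q).length + (g q).length)
      (fun _ _ => Nat.zero_le _) (Finset.mem_univ q)
  rintro w ⟨x, y, hxy⟩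
  have hx := hf (M.eval x) ⟨x, rfl⟩
  have hxy1 : f (M.eval x) ++ w ++ y ∈ L := by
    rw [List.append_assoc, hmem, hx, ← hmem, ← List.append_assoc]
    exact hxy
  refine ⟨f (M.eval x), g (M.eval (f (M.eval x) ++ w)), ?_, ?_, ?_⟩
  · have := hle (M.eval x); omega
  · have := hle (M.eval (f (M.eval x) ++ w)); omega
  · rw [hmem]
    exact hg _ ⟨y, (hmem _ _).1 hxy1⟩

theorem wdist_factor (π : FreeMonoid A →* G) (hπ : Function.Surjective π) (C : ℕ)
    (x u y : List A) (hx : x.length ≤ C) (hy : y.length ≤ C) (n : ℕ) :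
    wdist π (evalW π (u.take n)) ((evalW π x)⁻¹ * evalW π ((x ++ u ++ y).take n)) ≤ C := by
  rw [← wdist_mul_left π (evalW π x), mul_inv_cancel_left, ← evalW_append]
  have e : x ++ u.take n = (x ++ u ++ y).take (x.length + min n u.length) := by
    rw [List.append_assoc, List.take_length_add_append, List.take_append_of_le_length (by omega)]
    rcases le_total n u.length with h | h
    · rw [min_eq_left h]
    · rw [min_eq_right h, List.take_length, List.take_of_length_le h]
  rw [e]
  rcases le_total (x.length + min n u.length) n with h | h
  · refine (wdist_take_take π _ _ _ h).trans ?_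
    simp only [List.length_append]; omega
  · rw [wdist_comm π hπ]
    refine (wdist_take_take π _ _ _ h).trans ?_
    simp only [List.length_append]; omega

end Helpers

end Auto

/-- Every biautomatic group has a factorial automatic structure admitting a
departure function. -/
theorem exists_factorial_automatic_with_departure {A G : Type*} [Fintype A] [Group G]
    (π : FreeMonoid A →* G) (hπ : Function.Surjective π)
    (L : Language A) (hL : IsBiautomaticStructure π L) :
    ∃ L' : Language A, IsFactorial L' ∧ IsAutomaticStructure π L' ∧
      ∃ D : ℝ≥0 → ℝ≥0, IsDepartureFunction π L' D := by
  obtain ⟨C, hC⟩ := facLang_bounded (minLang_regular π hπ hL.toIsAutomaticStructure)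
  refine ⟨facLang (minLang π L), ?_, ⟨?_, ?_, ?_⟩, ?_⟩
  · rintro u ⟨x, y, hxy⟩ v ⟨s, t, rfl⟩
    exact ⟨x ++ s, t ++ y, by simpa using hxy⟩
  · exact facLang_regular (minLang_regular π hπ hL.toIsAutomaticStructure)
  · intro g
    obtain ⟨w, hw, h⟩ := minLang_onto π hL.onto g
    exact ⟨w, ⟨[], [], by simpa using hw⟩, h⟩
  · obtain ⟨K, hK⟩ := ft_both π hπ hL (2 * C + 1)
    refine ⟨C + K + C, ?_⟩
    intro u hu v hv huv n
    obtain ⟨x, y, hx, hy, hxy⟩ := hC u hu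
    obtain ⟨x', y', hx', hy', hxy'⟩ := hC v hv
    have b1 := wdist_one_evalW π x
    have b2 := wdist_one_evalW π y
    have b3 := wdist_one_evalW π x'
    have b4 := wdist_one_evalW π y'
    have key := hK _ hxy.1 _ hxy'.1 (evalW π x' * (evalW π x)⁻¹)
      ((evalW π y)⁻¹ * ((evalW π u)⁻¹ * evalW π v) * evalW π y') (by
        have := wdist_one_mul π hπ (evalW π x') (evalW π x)⁻¹
        rw [wdist_one_inv π hπ] at this
        omega) (by
        have h1 := wdist_one_mul π hπ ((evalW π y)⁻¹ * ((evalW π u)⁻¹ * evalW π v)) (evalW π y')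
        have h2 := wdist_one_mul π hπ (evalW π y)⁻¹ ((evalW π u)⁻¹ * evalW π v)
        rw [wdist_one_inv π hπ] at h2
        rw [wdist_eq_one] at huv
        omega) (by simp only [evalW_append]; group) n
    have f1 := wdist_factor π hπ C x u y hx hy n
    have f2 := wdist_factor π hπ C x' v y' hx' hy' n
    rw [wdist_comm π hπ] at f2
    rw [← wdist_mul_left π (evalW π x')⁻¹, mul_assoc, inv_mul_cancel_left] at key
    have t1 := wdist_triangle π hπ (evalW π (u.take n))
      ((evalW π x)⁻¹ * evalW π ((x ++ u ++ y).take n)) (evalW π (v.take n))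
    have t2 := wdist_triangle π hπ ((evalW π x)⁻¹ * evalW π ((x ++ u ++ y).take n))
      ((evalW π x')⁻¹ * evalW π ((x' ++ v ++ y').take n)) (evalW π (v.take n))
    have : wdist π (evalW π (u.take n)) (evalW π (v.take n)) ≤ C + K + C := by omega
    exact_mod_cast this
  · have hB : ∀ R : ℕ, ∃ b : ℕ, ∀ w ∈ minLang π L, wdist π 1 (evalW π w) ≤ R → w.length ≤ b := by
      intro R
      choose f hf hf' using minLang_onto π hL.onto
      obtain ⟨b, hb⟩ := ((ball_finite π hπ R).image (fun g => (f g).length)).bddAbove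
      refine ⟨b, fun w hw hwR => ?_⟩
      refine (hw.2 (f (evalW π w)) (hf _).1 (hf' _)).trans (hb ⟨evalW π w, hwR, rfl⟩)
    choose b hb using hB
    refine ⟨fun r => ((b (2 * C + ⌊r⌋₊) + 1 : ℕ) : ℝ≥0), ?_⟩
    intro w hw r s t ht hst
    have ht' : b (2 * C + ⌊r⌋₊) + 1 ≤ t := by
      simp only at ht
      exact_mod_cast ht
    by_contra hcon
    rw [not_lt] at hcon
    have hcon' := Nat.le_floor hcon
    have e : w.take (s + t) = w.take s ++ (w.drop s).take t := List.take_add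
    rw [e, evalW_append, wdist_eq_one, inv_mul_cancel_left] at hcon'
    obtain ⟨x₀, y₀, h₀⟩ := hw
    have hfac : (w.drop s).take t ∈ facLang (minLang π L) := by
      refine ⟨x₀ ++ w.take s, (w.drop s).drop t ++ y₀, ?_⟩
      have : x₀ ++ w.take s ++ (w.drop s).take t ++ ((w.drop s).drop t ++ y₀) = x₀ ++ w ++ y₀ := by
        conv_rhs => rw [← List.take_append_drop s w, ← List.take_append_drop t (w.drop s)]
        simp only [List.append_assoc]
      rw [this]; exact h₀
    obtain ⟨x, y, hx, hy, hxy⟩ := hC _ hfac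
    have b1 := wdist_one_evalW π x
    have b2 := wdist_one_evalW π y
    have := hb (2 * C + ⌊r⌋₊) _ hxy (by
      rw [evalW_append, evalW_append]
      have h1 := wdist_one_mul π hπ (evalW π x * evalW π ((w.drop s).take t)) (evalW π y)
      have h2 := wdist_one_mul π hπ (evalW π x) (evalW π ((w.drop s).take t))
      omega)
    simp only [List.length_append, List.length_take, List.length_drop] at this
    omega
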